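/- arXiv:1307.6118 — 2 statements merged into one kernel-verified Lean document; each statement's English description precedes it below -/
import Mathlib

section
/- Let A be a unital C*-algebra, X a compact Hausdorff space, and φ : A → C(X,ℂ) a bounded self-adjoint linear map. Then for every finite subset F ⊆ A and every δ > 0 there exist positive linear maps ψ₊, ψ₋ : A → C(X,ℂ) such that (ψ₊ − ψ₋)(a) = φ(a) for all a ∈ F and ‖(ψ₊)_t‖ + ‖(ψ₋)_t‖ ≤ ‖φ_t‖ + δ for every t ∈ X. In particular, every bounded self-adjoint linear map from a unital C*-algebra into C(X,ℂ) is the elementwise limit of decomposable maps (differences of two positive linear maps). -/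
/-- For a bounded linear map `φ : A → C(X, ℂ)` and `t ∈ X`, the functional
`φ_t : A → ℂ`, `a ↦ φ(a)(t)`, obtained by composing with evaluation at `t`. -/
noncomputable def fiberFunctional {A : Type*} [CStarAlgebra A]
    {X : Type*} [TopologicalSpace X] [CompactSpace X]
    (φ : A →L[ℂ] C(X, ℂ)) (t : X) : A →L[ℂ] ℂ :=
  (ContinuousMap.evalCLM ℂ t).comp φ

/-- A linear map `ψ : A → C(X, ℂ)` is positive if `ψ a` is a nonnegative
real-valued function whenever `0 ≤ a` in `A`. -/
def IsPosMap {A : Type*} [CStarAlgebra A] [PartialOrder A] [StarOrderedRing A]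
    {X : Type*} [TopologicalSpace X] [CompactSpace X]
    (ψ : A →L[ℂ] C(X, ℂ)) : Prop :=
  ∀ a : A, 0 ≤ a → ∀ t : X, (ψ a t).im = 0 ∧ 0 ≤ (ψ a t).re


open scoped ComplexOrder ComplexStarModule

section PositiveFunctionals

variable {A : Type*} [CStarAlgebra A] [PartialOrder A] [StarOrderedRing A]

/-- A selfadjoint element of a unital C*-algebra lying between `-r` and `r` has norm at most `r`. -/
theorem norm_le_of_neg_algebraMap_le_of_le_algebraMap {c : A} {r : ℝ} (hr : 0 ≤ r)
    (hc : IsSelfAdjoint c) (h₁ : algebraMap ℝ A (-r) ≤ c) (h₂ : c ≤ algebraMap ℝ A r) :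
    ‖c‖ ≤ r := by
  cases subsingleton_or_nontrivial A
  · rwa [Subsingleton.elim c 0, norm_zero]
  have h₁' := (algebraMap_le_iff_le_spectrum (r := -r) (a := c)).1 h₁
  have h₂' := (le_algebraMap_iff_spectrum_le (r := r) (a := c)).1 h₂
  rcases CStarAlgebra.norm_or_neg_norm_mem_spectrum hc with h | h
  · exact h₂' _ h
  · linarith [h₁' _ h]

theorem re_apply_le_of_le_algebraMap (f : A →L[ℂ] ℂ) {b : A} {l : ℝ} (hl : 0 ≤ l)
    (hb : 0 ≤ b) (hbl : b ≤ algebraMap ℝ A l) :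
    (f b).re ≤ l * ((‖f‖ + (f 1).re) / 2) := by
  have hhalf : algebraMap ℝ A l = algebraMap ℝ A (l / 2) + algebraMap ℝ A (l / 2) := by
    rw [← map_add, add_halves]
  have hnorm : ‖b - algebraMap ℝ A (l / 2)‖ ≤ l / 2 := by
    apply norm_le_of_neg_algebraMap_le_of_le_algebraMap (by positivity)
    · exact (IsSelfAdjoint.of_nonneg hb).sub (IsSelfAdjoint.algebraMap A (.all _))
    · rw [map_neg, neg_le_sub_iff_le_add]
      exact le_add_of_nonneg_left hb
    · rw [sub_le_iff_le_add, ← hhalf]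
      exact hbl
  have h := (Complex.re_le_norm _).trans (f.le_of_opNorm_le_of_le le_rfl hnorm)
  have h1 : f (algebraMap ℝ A (l / 2)) = ((l / 2 : ℝ) : ℂ) * f 1 := by
    rw [Algebra.algebraMap_eq_smul_one, ← Complex.coe_smul, map_smul, smul_eq_mul]
  rw [map_sub, h1, Complex.sub_re, Complex.re_ofReal_mul] at h
  linarith

theorem im_apply_eq_zero_of_nonneg {g : A →ₗ[ℂ] ℂ} (hg : ∀ a, 0 ≤ a → 0 ≤ g a) {h : A}
    (hh : IsSelfAdjoint h) : (g h).im = 0 := by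
  have h1 := hg _ (sub_nonneg.2 hh.le_algebraMap_norm_self)
  have h2 := hg (algebraMap ℝ A ‖h‖) (algebraMap_nonneg A (norm_nonneg h))
  rw [map_sub, Complex.nonneg_iff, Complex.sub_im] at h1
  rw [Complex.nonneg_iff] at h2
  linarith [h1.2, h2.2]

/-- A positive functional on a unital C*-algebra is bounded by its value at `1`. -/
theorem norm_le_re_apply_one_of_nonneg (g : A →L[ℂ] ℂ) (hg : ∀ a, 0 ≤ a → 0 ≤ g a) :
    ‖g‖ ≤ (g 1).re := by
  have key : ∀ x, (g x).re ≤ (g 1).re * ‖x‖ := fun x ↦ by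
    have h1 := hg _ (sub_nonneg.2 (ℜ x).2.le_algebraMap_norm_self)
    rw [map_sub, Complex.nonneg_iff, Complex.sub_re, Algebra.algebraMap_eq_smul_one,
      ← Complex.coe_smul, map_smul, smul_eq_mul, Complex.re_ofReal_mul] at h1
    have h2 : (g x).re = (g (ℜ x : A)).re := by
      conv_lhs => rw [← realPart_add_I_smul_imaginaryPart x]
      have := im_apply_eq_zero_of_nonneg (g := g.toLinearMap) hg (ℑ x).2
      simp only [ContinuousLinearMap.coe_coe] at this
      simp [this]
    have h3 : ‖(ℜ x : A)‖ ≤ ‖x‖ := realPart.norm_le x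
    have h4 := (Complex.nonneg_iff.1 (hg 1 zero_le_one)).1
    nlinarith [h1.1]
  refine g.opNorm_le_bound (Complex.nonneg_iff.1 (hg 1 zero_le_one)).1 fun x ↦ ?_
  rcases eq_or_ne (g x) 0 with h0 | h0
  · rw [h0, norm_zero]
    exact mul_nonneg (Complex.nonneg_iff.1 (hg 1 zero_le_one)).1 (norm_nonneg x)
  have hn : (‖g x‖ : ℂ) ≠ 0 := by simpa using h0
  set z : ℂ := (starRingEnd ℂ) (g x) / ‖g x‖ with hz
  have hz1 : ‖z‖ = 1 := by simp [hz, h0]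
  have := key (z • x)
  rw [map_smul, norm_smul, hz1, one_mul, smul_eq_mul] at this
  convert this using 1
  have : z * g x = ‖g x‖ := by
    rw [hz, div_mul_eq_mul_div, mul_comm, Complex.mul_conj', sq, mul_div_assoc, div_self hn, mul_one]
  rw [this, Complex.ofReal_re]

/-- The cone of pairs `(a, μ)` on which every functional `(a, μ) ↦ p (ℜ a) + μ` must be
nonnegative, when `p` is positive, dominates `f` on the positive cone and `p 1 ≤ r`. -/
def dominationCone (f : A →L[ℂ] ℂ) (r : ℝ) : PointedCone ℝ (A × ℝ) where
  carrier := {x | ∃ (b : A) (l : ℝ), 0 ≤ l ∧ 0 ≤ b ∧ b ≤ (ℜ x.1 : A) + l • (1 : A) ∧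
    l * r - (f b).re ≤ x.2}
  zero_mem' := ⟨0, 0, le_rfl, le_rfl, by simp, by simp⟩
  add_mem' := by
    rintro x y ⟨b, l, hl, hb, hbl, hx⟩ ⟨c, m, hm, hc, hcm, hy⟩
    refine ⟨b + c, l + m, add_nonneg hl hm, add_nonneg hb hc, ?_, ?_⟩
    · refine (add_le_add hbl hcm).trans_eq ?_
      simp only [Prod.fst_add, map_add, AddSubgroup.coe_add, add_smul]
      abel
    · simp only [map_add, Complex.add_re, Prod.snd_add]
      linarith
  smul_mem' := by
    rintro ⟨c, hc⟩ x ⟨b, l, hl, hb, hbl, hx⟩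
    refine ⟨c • b, c * l, mul_nonneg hc hl, smul_nonneg hc hb, ?_, ?_⟩
    · refine (smul_le_smul_of_nonneg_left hbl hc).trans_eq ?_
      simp [smul_add, mul_smul, Nonneg.mk_smul]
    · have : f (c • b) = (c : ℂ) * f b := by
        rw [← Complex.coe_smul, map_smul, smul_eq_mul]
      simp only [this, Complex.re_ofReal_mul, Nonneg.mk_smul, Prod.smul_snd, smul_eq_mul]
      nlinarith

/-- A real functional `p` with `0 ≤ p`, `f ≤ p` on the positive cone and
`p 1 ≤ (‖f‖ + f 1) / 2`. -/
theorem exists_real_positive_dominating (f : A →L[ℂ] ℂ) :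
    ∃ p : A →ₗ[ℝ] ℝ, (∀ a, IsSelfAdjoint a → p (Complex.I • a) = 0) ∧ (∀ a, 0 ≤ a → 0 ≤ p a) ∧
      (∀ a, 0 ≤ a → (f a).re ≤ p a) ∧ p 1 ≤ (‖f‖ + (f 1).re) / 2 := by
  set r := (‖f‖ + (f 1).re) / 2
  let d : A × ℝ →ₗ.[ℝ] ℝ := ⟨Submodule.prod ⊥ ⊤, (LinearMap.snd ℝ A ℝ).domRestrict _⟩
  obtain ⟨g, hgd, hg⟩ := riesz_extension (dominationCone f r) d
    (by
      rintro ⟨⟨a, μ⟩, ha, _⟩ ⟨b, l, hl, hb, hbl, hx⟩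
      obtain rfl : a = 0 := ha
      change 0 ≤ μ
      change l * r - (f b).re ≤ μ at hx
      have hbl' : b ≤ algebraMap ℝ A l := by
        simpa [Algebra.algebraMap_eq_smul_one] using hbl
      have hfb : (f b).re ≤ l * r := re_apply_le_of_le_algebraMap f hl hb hbl'
      linarith)
    (by
      rintro ⟨a, μ⟩
      refine ⟨⟨(0, ‖(ℜ a : A)‖ * r - μ), ⟨rfl, trivial⟩⟩, 0, ‖(ℜ a : A)‖, norm_nonneg _,
        le_rfl, ?_, ?_⟩
      · have := (ℜ a).2.neg_algebraMap_norm_le_self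
        rw [neg_le_iff_add_nonneg, Algebra.algebraMap_eq_smul_one] at this
        simpa using this
      · simp)
  have hg0 : ∀ μ : ℝ, g (0, μ) = μ := fun μ ↦ hgd ⟨(0, μ), ⟨rfl, trivial⟩⟩
  have hgs : ∀ (a : A) (μ : ℝ), g (a, μ) = g (a, 0) + μ := fun a μ ↦ by
    conv_rhs => rw [← hg0 μ, ← map_add]
    simp
  have hI : ∀ a, IsSelfAdjoint a → 0 ≤ g (Complex.I • a, 0) := fun a ha ↦ by
    refine hg _ ⟨0, 0, le_rfl, le_rfl, ?_, by simp⟩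
    simp [ha.imaginaryPart]
  refine ⟨g ∘ₗ LinearMap.inl ℝ A ℝ, fun a ha ↦ ?_, fun a ha ↦ ?_, fun a ha ↦ ?_, ?_⟩
  · have h1 := hI a ha
    have h2 := hI (-a) ha.neg
    have h3 : ((Complex.I • -a, 0) : A × ℝ) = -(Complex.I • a, 0) := by simp
    rw [h3, map_neg] at h2
    simp only [LinearMap.comp_apply, LinearMap.inl_apply]
    linarith
  · refine hg (a, 0) ⟨0, 0, le_rfl, le_rfl, ?_, by simp⟩
    simpa [(IsSelfAdjoint.of_nonneg ha).coe_realPart] using ha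
  · have := hg (a, -(f a).re) ⟨a, 0, le_rfl, ha, ?_, by simp⟩
    · rw [hgs] at this
      simpa using this
    · simp [(IsSelfAdjoint.of_nonneg ha).coe_realPart]
  · have := hg (-1, r) ⟨0, 1, zero_le_one, le_rfl, ?_, by simp⟩
    · rw [hgs] at this
      have h3 : ((-1, 0) : A × ℝ) = -(1, 0) := by simp
      rw [h3, map_neg] at this
      simp only [LinearMap.comp_apply, LinearMap.inl_apply]
      linarith
    · simp

/-- Jordan decomposition of a bounded hermitian functional on a unital C*-algebra. -/
theorem exists_jordan_decomposition (f : A →L[ℂ] ℂ) (hf : ∀ a, f (star a) = star (f a)) :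
    ∃ p q : A →L[ℂ] ℂ, (∀ a, 0 ≤ a → 0 ≤ p a) ∧ (∀ a, 0 ≤ a → 0 ≤ q a) ∧ f = p - q ∧
      (p 1).re + (q 1).re ≤ ‖f‖ := by
  obtain ⟨p, hpI, hp0, hpf, hp1⟩ := exists_real_positive_dominating f
  let P : A →ₗ[ℂ] ℂ := Module.Dual.extendRCLike p
  have hPre : ∀ a, (P a).re = p a := fun a ↦ Module.Dual.re_extendRCLike_apply (𝕜 := ℂ) p a
  have hPim : ∀ a, (P a).im = -p (Complex.I • a) := fun a ↦
    Module.Dual.im_extendRCLike_apply (𝕜 := ℂ) p a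
  have hP : ∀ a, 0 ≤ a → 0 ≤ P a := fun a ha ↦ by
    rw [Complex.nonneg_iff, hPre, hPim, hpI a (.of_nonneg ha)]
    simpa using hp0 a ha
  let P' : A →L[ℂ] ℂ := ⟨P, map_continuous (PositiveLinearMap.mk₀ P hP)⟩
  have hP' : ∀ a, P' a = P a := fun _ ↦ rfl
  refine ⟨P', P' - f, hP, fun a ha ↦ ?_, by simp, ?_⟩
  · have him : (f a).im = 0 := by
      have := hf a
      rw [(IsSelfAdjoint.of_nonneg ha).star_eq] at this
      exact Complex.conj_eq_iff_im.1 this.symm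
    have h0 := (Complex.nonneg_iff.1 (hP a ha)).2
    rw [sub_apply, hP', Complex.nonneg_iff, Complex.sub_re, Complex.sub_im,
      hPre, him, ← h0]
    simpa using hpf a ha
  · rw [sub_apply, hP', Complex.sub_re, hPre]
    linarith

end PositiveFunctionals

section FiniteDimensional

variable {A : Type*} [CStarAlgebra A]

/-- The hermitian part of a bounded functional. -/
noncomputable def hermitianPart (f : A →L[ℂ] ℂ) : A →L[ℂ] ℂ :=
  (2⁻¹ : ℂ) • (f + (starL ℂ : ℂ ≃L⋆[ℂ] ℂ).toContinuousLinearMap.comp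
    (f.comp (starL ℂ : A ≃L⋆[ℂ] A).toContinuousLinearMap))

theorem hermitianPart_apply (f : A →L[ℂ] ℂ) (a : A) :
    hermitianPart f a = 2⁻¹ * (f a + star (f (star a))) := rfl

theorem hermitianPart_star (f : A →L[ℂ] ℂ) (a : A) :
    hermitianPart f (star a) = star (hermitianPart f a) := by
  simp [hermitianPart_apply, add_comm]

/-- A finite set in a C*-algebra admits a finite selfadjoint coordinate system with hermitian
bounded coordinate functionals. -/
theorem exists_hermitian_coordinates (F : Finset A) :
    ∃ (G : Finset A) (f : G → A →L[ℂ] ℂ), (∀ g ∈ G, IsSelfAdjoint g) ∧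
      (∀ i a, f i (star a) = star (f i a)) ∧ ∀ a ∈ F, a = ∑ i, f i a • (i : A) := by
  classical
  let G : Finset A := F.image (fun a ↦ (ℜ a : A)) ∪ F.image (fun a ↦ (ℑ a : A))
  have hG : ∀ g ∈ G, IsSelfAdjoint g := by
    intro g hg
    rcases Finset.mem_union.1 hg with h | h <;> obtain ⟨a, -, rfl⟩ := Finset.mem_image.1 h
    exacts [(ℜ a).2, (ℑ a).2]
  let L : (G → ℂ) →ₗ[ℂ] A := Fintype.linearCombination ℂ (fun i : G ↦ (i : A))
  have hL : ∀ c, L c = ∑ i, c i • (i : A) := fun _ ↦ rfl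
  obtain ⟨s, hs⟩ := L.rangeRestrict.exists_rightInverse_of_surjective L.range_rangeRestrict
  obtain ⟨P, hP⟩ := ContinuousLinearMap.exist_extension_of_finiteDimensional_range
    (LinearMap.toContinuousLinearMap s)
  have hLP : ∀ a ∈ L.range, L (P a) = a := fun a ha ↦ by
    have h1 : s ⟨a, ha⟩ = P a := congr($hP ⟨a, ha⟩)
    rw [← h1]
    exact congr(($hs ⟨a, ha⟩ : A))
  have hmem : ∀ g ∈ G, g ∈ L.range := fun g hg ↦
    ⟨Pi.single ⟨g, hg⟩ 1, by simp [L]⟩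
  have hF : ∀ a ∈ F, (ℜ a : A) ∈ G ∧ (ℑ a : A) ∈ G := fun a ha ↦
    ⟨Finset.mem_union_left _ (Finset.mem_image_of_mem _ ha),
      Finset.mem_union_right _ (Finset.mem_image_of_mem _ ha)⟩
  have hF₁ : ∀ a ∈ F, a ∈ L.range := fun a ha ↦ by
    rw [← realPart_add_I_smul_imaginaryPart a]
    exact add_mem (hmem _ (hF a ha).1) (Submodule.smul_mem _ _ (hmem _ (hF a ha).2))
  have hF₂ : ∀ a ∈ F, star a ∈ L.range := fun a ha ↦ by
    rw [← realPart_add_I_smul_imaginaryPart a, star_add, star_smul, (ℜ a).2.star_eq,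
      (ℑ a).2.star_eq]
    exact add_mem (hmem _ (hF a ha).1) (Submodule.smul_mem _ _ (hmem _ (hF a ha).2))
  refine ⟨G, fun i ↦ hermitianPart ((ContinuousLinearMap.proj i).comp P), hG,
    fun i a ↦ hermitianPart_star _ a, fun a ha ↦ ?_⟩
  have h1 : ∑ i, P a i • (i : A) = a := hLP a (hF₁ a ha)
  have h2 : ∑ i, star (P (star a) i) • (i : A) = a := by
    have := congr(star $(hLP _ (hF₂ a ha)))
    rw [hL, star_sum, star_star] at this
    refine Eq.trans ?_ this
    refine Finset.sum_congr rfl fun i _ ↦ ?_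
    rw [star_smul, (hG i i.2).star_eq]
  have h3 : a = (2⁻¹ : ℂ) • (∑ i, P a i • (i : A) + ∑ i, star (P (star a) i) • (i : A)) := by
    rw [h1, h2, ← two_smul ℂ a, smul_smul]
    simp
  conv_lhs => rw [h3]
  rw [← Finset.sum_add_distrib, Finset.smul_sum]
  refine Finset.sum_congr rfl fun i _ ↦ ?_
  rw [hermitianPart_apply, ← add_smul, smul_smul]
  rfl

end FiniteDimensional

section Gluing

variable {A : Type*} [CStarAlgebra A] {X : Type*} [TopologicalSpace X] [CompactSpace X]

theorem eventually_norm_fiberFunctional_lt (φ : A →L[ℂ] C(X, ℂ)) (t₀ : X) {η : ℝ} (hη : 0 < η) :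
    ∀ᶠ t in nhds t₀, ‖fiberFunctional φ t₀‖ < ‖fiberFunctional φ t‖ + η := by
  obtain ⟨a, ha, h⟩ := (fiberFunctional φ t₀).exists_lt_apply_of_lt_opNorm
    (sub_lt_self ‖fiberFunctional φ t₀‖ hη)
  filter_upwards [((φ a).continuous.norm.tendsto t₀).eventually (lt_mem_nhds h)] with t ht
  have := (fiberFunctional φ t).unit_le_opNorm a ha.le
  change _ < ‖fiberFunctional φ t a‖ at ht
  linarith

/-- A bounded map into `C(X, ℂ)` can be approximated on finitely many elements by averaging finitely
many of its fibers, without increasing the norm of the fibers by much. -/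
theorem exists_partition_fiberFunctional [T2Space X] (φ : A →L[ℂ] C(X, ℂ)) (G : Finset A)
    {ε η : ℝ} (hε : 0 < ε) (hη : 0 < η) :
    ∃ (T : Finset X) (ρ : T → C(X, ℝ)), (∀ j t, 0 ≤ ρ j t) ∧ (∀ t, ∑ j, ρ j t = 1) ∧
      (∀ j t, ρ j t ≠ 0 → ‖fiberFunctional φ j‖ ≤ ‖fiberFunctional φ t‖ + η) ∧
      ∀ j t, ρ j t ≠ 0 → ∀ a ∈ G, ‖φ a t - φ a j‖ ≤ ε := by
  let U : X → Set X := fun t₀ ↦ {t | ‖fiberFunctional φ t₀‖ < ‖fiberFunctional φ t‖ + η ∧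
    ∀ a ∈ G, ‖φ a t - φ a t₀‖ < ε}
  have hU : ∀ t₀, U t₀ ∈ nhds t₀ := fun t₀ ↦ by
    refine (eventually_norm_fiberFunctional_lt φ t₀ hη).and
      ((Finset.eventually_all G).2 fun a _ ↦ ?_)
    have hc : Continuous fun t ↦ ‖φ a t - φ a t₀‖ := by fun_prop
    exact (hc.tendsto t₀).eventually (gt_mem_nhds (by simpa using hε))
  obtain ⟨T, -, hT⟩ := isCompact_univ.elim_nhds_subcover (fun t ↦ interior (U t))
    fun t _ ↦ interior_mem_nhds.2 (hU t)
  obtain ⟨ρ, hρ⟩ := PartitionOfUnity.exists_isSubordinate isClosed_univ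
    (fun j : T ↦ interior (U j)) (fun _ ↦ isOpen_interior)
    (by simpa [Set.iUnion_subtype] using hT)
  have hmem : ∀ j t, ρ j t ≠ 0 → t ∈ U j := fun j t h ↦
    interior_subset (hρ j (subset_tsupport _ h))
  refine ⟨T, ρ, ρ.nonneg, fun t ↦ ?_, fun j t h ↦ (hmem j t h).1.le,
    fun j t h a ha ↦ ((hmem j t h).2 a ha).le⟩
  rw [← finsum_eq_sum_of_fintype]
  exact ρ.sum_eq_one (Set.mem_univ t)

/-- A continuous real function regarded as a complex one. -/
def complexOfReal (h : C(X, ℝ)) : C(X, ℂ) := ⟨fun t ↦ (h t : ℂ), by fun_prop⟩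

/-- The map `a ↦ ∑ i, p i a • h i` into `C(X, ℂ)`. -/
noncomputable def weightedSum {ι : Type*} [Fintype ι] (p : ι → A →L[ℂ] ℂ) (h : ι → C(X, ℝ)) :
    A →L[ℂ] C(X, ℂ) :=
  ∑ i, (p i).smulRight (complexOfReal (h i))

theorem weightedSum_apply {ι : Type*} [Fintype ι] (p : ι → A →L[ℂ] ℂ) (h : ι → C(X, ℝ)) (a : A)
    (t : X) : weightedSum p h a t = ∑ i, p i a * h i t := by
  simp [weightedSum, complexOfReal]

theorem re_weightedSum_apply {ι : Type*} [Fintype ι] (p : ι → A →L[ℂ] ℂ) (h : ι → C(X, ℝ)) (a : A)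
    (t : X) : (weightedSum p h a t).re = ∑ i, (p i a).re * h i t := by
  simp [weightedSum_apply]

variable [PartialOrder A] [StarOrderedRing A]

theorem isPosMap_iff {ψ : A →L[ℂ] C(X, ℂ)} : IsPosMap ψ ↔ ∀ a, 0 ≤ a → ∀ t, 0 ≤ ψ a t := by
  simp only [IsPosMap, Complex.nonneg_iff, and_comm, eq_comm]

theorem IsPosMap.add {ψ χ : A →L[ℂ] C(X, ℂ)} (hψ : IsPosMap ψ) (hχ : IsPosMap χ) :
    IsPosMap (ψ + χ) := by
  rw [isPosMap_iff] at *
  exact fun a ha t ↦ add_nonneg (hψ a ha t) (hχ a ha t)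

theorem IsPosMap.norm_fiberFunctional_le {ψ : A →L[ℂ] C(X, ℂ)} (hψ : IsPosMap ψ) (t : X) :
    ‖fiberFunctional ψ t‖ ≤ (ψ 1 t).re :=
  norm_le_re_apply_one_of_nonneg (fiberFunctional ψ t) fun a ha ↦ isPosMap_iff.1 hψ a ha t

theorem isPosMap_weightedSum {ι : Type*} [Fintype ι] {p : ι → A →L[ℂ] ℂ} {h : ι → C(X, ℝ)}
    (hp : ∀ i a, 0 ≤ a → 0 ≤ p i a) (hh : ∀ i t, 0 ≤ h i t) : IsPosMap (weightedSum p h) := by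
  refine isPosMap_iff.2 fun a ha t ↦ ?_
  rw [weightedSum_apply]
  exact Finset.sum_nonneg fun i _ ↦
    mul_nonneg (hp i a ha) (Complex.zero_le_real.2 (hh i t))

end Gluing

/-- Remark (ii).  Let `A` be a unital C*-algebra, `X` a compact
Hausdorff space and `φ : A → C(X, ℂ)` a bounded self-adjoint linear map.  Then for
every finite subset `F ⊆ A` and every `δ > 0` there are positive linear maps
`ψ₊, ψ₋ : A → C(X, ℂ)` with `(ψ₊ - ψ₋)(a) = φ(a)` for all `a ∈ F` and
`‖(ψ₊)_t‖ + ‖(ψ₋)_t‖ ≤ ‖φ_t‖ + δ` for every `t ∈ X`; in other words, every bounded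
self-adjoint linear map into `C(X, ℂ)` is the elementwise limit of (Jordan)
decomposable maps. -/
theorem stmt9
    {A : Type*} [CStarAlgebra A] [PartialOrder A] [StarOrderedRing A]
    {X : Type*} [TopologicalSpace X] [CompactSpace X] [T2Space X]
    (φ : A →L[ℂ] C(X, ℂ))
    (hsa : ∀ a : A, φ (star a) = star (φ a))
    (F : Finset A) (δ : ℝ) (hδ : 0 < δ) :
    ∃ ψp ψm : A →L[ℂ] C(X, ℂ), IsPosMap ψp ∧ IsPosMap ψm ∧
      (∀ a ∈ F, (ψp - ψm) a = φ a) ∧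
      ∀ t : X, ‖fiberFunctional ψp t‖ + ‖fiberFunctional ψm t‖ ≤
        ‖fiberFunctional φ t‖ + δ := by
  obtain ⟨G, f, hG, hf, hGF⟩ := exists_hermitian_coordinates F
  choose fp fm hfp hfm hfj hfn using fun i ↦ exists_jordan_decomposition (f i) (hf i)
  have hφ : ∀ t a, fiberFunctional φ t (star a) = star (fiberFunctional φ t a) :=
    fun t a ↦ congr($(hsa a) t)
  choose p q hp hq hpq hpqn using fun t ↦ exists_jordan_decomposition _ (hφ t)
  set M : ℝ := ∑ i, ‖f i‖
  have hM : 0 ≤ M := Finset.sum_nonneg fun i _ ↦ norm_nonneg _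
  obtain ⟨T, ρ, hρ0, hρ1, hρn, hρε⟩ := exists_partition_fiberFunctional φ G
    (show 0 < δ / 2 / (M + 1) by positivity) (half_pos hδ)
  set ε := δ / 2 / (M + 1)
  let re (a : A) : C(X, ℝ) := ⟨fun t ↦ (φ a t).re, by fun_prop⟩
  let c (i : G) : C(X, ℝ) := re i - ∑ j : T, (φ i j).re • ρ j
  have hc : ∀ i t, c i t = (φ i t).re - ∑ j : T, (φ i j).re * ρ j t := fun i t ↦ by
    simp [c, re, ContinuousMap.sum_apply]
  have hcε : ∀ i t, |c i t| ≤ ε := fun i t ↦ by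
    have h1 : c i t = ∑ j : T, ((φ i t).re - (φ i j).re) * ρ j t := by
      simp only [hc, sub_mul, Finset.sum_sub_distrib, ← Finset.mul_sum, hρ1, mul_one]
    calc |c i t| ≤ ∑ j : T, |((φ i t).re - (φ i j).re) * ρ j t| := by
          rw [h1]
          exact Finset.abs_sum_le_sum_abs _ _
      _ ≤ ∑ j : T, ε * ρ j t := Finset.sum_le_sum fun j _ ↦ by
          rw [abs_mul, abs_of_nonneg (hρ0 j t)]
          by_cases h0 : ρ j t = 0
          · simp [h0]
          · refine mul_le_mul_of_nonneg_right ?_ (hρ0 j t)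
            rw [← Complex.sub_re]
            exact (Complex.abs_re_le_norm _).trans (hρε j t h0 i i.2)
      _ = ε := by rw [← Finset.mul_sum, hρ1, mul_one]
  have hre : ∀ (i : G) t, ((φ i t).re : ℂ) = φ i t := fun i t ↦ by
    have h1 := congr($(hsa i) t)
    rw [(hG i i.2).star_eq] at h1
    exact Complex.conj_eq_iff_re.1 h1.symm
  have hexp : ∀ a ∈ F, ∀ t, φ a t = ∑ i, f i a * (φ i t).re := fun a ha t ↦ by
    conv_lhs => rw [hGF a ha]
    simp [ContinuousMap.sum_apply, hre]
  let cp (i : G) : C(X, ℝ) := c i ⊔ 0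
  let cm (i : G) : C(X, ℝ) := -c i ⊔ 0
  have hcp : ∀ i t, 0 ≤ cp i t := fun i t ↦ le_sup_right
  have hcm : ∀ i t, 0 ≤ cm i t := fun i t ↦ le_sup_right
  have hcs : ∀ i t, cp i t - cm i t = c i t := fun i t ↦ max_zero_sub_eq_self (c i t)
  have hca : ∀ i t, cp i t + cm i t = |c i t| := fun i t ↦
    max_zero_add_max_neg_zero_eq_abs_self (c i t)
  have hpos : IsPosMap (weightedSum (fun j : T ↦ p j) ρ + weightedSum fp cp + weightedSum fm cm) :=
    ((isPosMap_weightedSum (fun j : T ↦ hp j) hρ0).add (isPosMap_weightedSum hfp hcp)).add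
      (isPosMap_weightedSum hfm hcm)
  have hneg : IsPosMap (weightedSum (fun j : T ↦ q j) ρ + weightedSum fp cm + weightedSum fm cp) :=
    ((isPosMap_weightedSum (fun j : T ↦ hq j) hρ0).add (isPosMap_weightedSum hfp hcm)).add
      (isPosMap_weightedSum hfm hcp)
  refine ⟨_, _, hpos, hneg, fun a ha ↦ ?_, fun t ↦ ?_⟩
  · ext t
    have h1 : ∑ j : T, φ a j * ρ j t = ∑ j : T, (p j a * ρ j t - q j a * ρ j t) :=
      Finset.sum_congr rfl fun j _ ↦ by
        rw [← sub_mul, ← sub_apply, ← hpq]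
        rfl
    have h2 : ∑ i, f i a * c i t =
        ∑ i, (fp i a * cp i t + fm i a * cm i t - (fp i a * cm i t + fm i a * cp i t)) :=
      Finset.sum_congr rfl fun i _ ↦ by
        rw [hfj i, sub_apply, ← hcs, Complex.ofReal_sub]
        ring
    have h3 : φ a t = ∑ j : T, φ a j * ρ j t + ∑ i, f i a * c i t := by
      simp only [hexp a ha, hc, Complex.ofReal_sub, mul_sub, Finset.sum_sub_distrib,
        Complex.ofReal_sum, Complex.ofReal_mul, Finset.mul_sum, Finset.sum_mul]
      rw [Finset.sum_comm]
      simp only [mul_assoc]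
      ring
    rw [h3, h1, h2]
    simp only [sub_apply, add_apply,
      ContinuousMap.sub_apply, ContinuousMap.add_apply, weightedSum_apply, Finset.sum_sub_distrib,
      Finset.sum_add_distrib]
    ring
  · refine (add_le_add (hpos.norm_fiberFunctional_le t) (hneg.norm_fiberFunctional_le t)).trans ?_
    have h1 : ∑ j : T, ((p j 1).re * ρ j t + (q j 1).re * ρ j t) ≤
        ‖fiberFunctional φ t‖ + δ / 2 :=
      calc _ ≤ ∑ j : T, (‖fiberFunctional φ t‖ + δ / 2) * ρ j t :=
            Finset.sum_le_sum fun j _ ↦ by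
              rw [← add_mul]
              by_cases h0 : ρ j t = 0
              · simp [h0]
              · exact mul_le_mul_of_nonneg_right ((hpqn j).trans (hρn j t h0)) (hρ0 j t)
        _ = _ := by rw [← Finset.mul_sum, hρ1, mul_one]
    have h2 : ∑ i, ((fp i 1).re * cp i t + (fm i 1).re * cm i t +
        ((fp i 1).re * cm i t + (fm i 1).re * cp i t)) ≤ δ / 2 :=
      calc _ ≤ ∑ i, ‖f i‖ * ε := Finset.sum_le_sum fun i _ ↦ by
            have h : ((fp i 1).re + (fm i 1).re) * |c i t| ≤ ‖f i‖ * ε :=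
              mul_le_mul (hfn i) (hcε i t) (abs_nonneg _) (norm_nonneg _)
            rw [← hca] at h
            linarith
        _ = M * ε := by rw [Finset.sum_mul]
        _ ≤ (M + 1) * ε := by
            have : 0 < ε := by positivity
            linarith
        _ = δ / 2 := mul_div_cancel₀ _ (by positivity)
    simp only [add_apply, ContinuousMap.add_apply, Complex.add_re,
      re_weightedSum_apply]
    simp only [Finset.sum_add_distrib] at h1 h2
    linarith
end

section
/- Let 𝔛 be a real normed space, 𝔜 ⊆ 𝔛 a subspace, X a compact Hausdorff space, and φ : 𝔜 → C(X,ℝ) a bounded linear map whose pointwise norm function N(t) = sup{ |φ(y)(t)| : y ∈ 𝔜, ‖y‖ ≤ 1 } is continuous on X. For x ∈ 𝔛 define Φ̄(x)(t) = sup{ f(x) : f : 𝔛 → ℝ linear, f(y) = φ(y)(t) for all y ∈ 𝔜, and ‖f‖ = N(t) } and Φ̲(x)(t) = inf{ f(x) : f : 𝔛 → ℝ linear, f(y) = φ(y)(t) for all y ∈ 𝔜, and ‖f‖ = N(t) }. Then for every x ∈ 𝔛 the function t ↦ Φ̄(x)(t) is upper semicontinuous and the function t ↦ Φ̲(x)(t)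 is lower semicontinuous on X. -/
/-- If `N` is continuous, the set of points `t` for which some extension `f` of `y ↦ φ y t`
bounded by `N t` satisfies `c ≤ f x` is closed. -/
theorem isClosed_setOf_exists_extension_le
    {E : Type*} [NormedAddCommGroup E] [NormedSpace ℝ E]
    {X : Type*} [TopologicalSpace X] [CompactSpace X] [T2Space X]
    (Y : Submodule ℝ E) (φ : Y → C(X, ℝ)) (N : X → ℝ) (hN : Continuous N) (x : E) (c : ℝ) :
    IsClosed {t : X | ∃ f : E →L[ℝ] ℝ, (∀ y : Y, f (y : E) = φ y t) ∧
      (∀ z, |f z| ≤ N t * ‖z‖) ∧ c ≤ f x} := by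
  obtain ⟨R, hR⟩ := (isCompact_range hN).bddAbove
  have hNR (t : X) : N t ≤ max R 0 := (hR ⟨t, rfl⟩).trans (le_max_left _ _)
  let C : Set (X × WeakDual ℝ E) := {p | (∀ y : Y, p.2 (y : E) = φ y p.1) ∧
      (∀ z, |p.2 z| ≤ N p.1 * ‖z‖) ∧ c ≤ p.2 x}
  have happly (z : E) : Continuous fun p : X × WeakDual ℝ E => p.2 z :=
    (WeakDual.eval_continuous z).comp continuous_snd
  have hC : IsClosed C := by
    simp only [C, Set.ofPred_and, Set.ofPred_forall]
    refine IsClosed.inter ?_ (IsClosed.inter ?_ ?_)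
    · exact isClosed_iInter fun y =>
        isClosed_eq (happly y) ((φ y).continuous.comp continuous_fst)
    · exact isClosed_iInter fun z =>
        isClosed_le (happly z).abs ((hN.comp continuous_fst).mul continuous_const)
    · exact isClosed_le continuous_const (happly x)
  have hK := (isCompact_univ (X := X)).prod
    (WeakDual.isCompact_closedBall (0 : StrongDual ℝ E) (max R 0))
  convert ((hK.inter_right hC).image continuous_fst).isClosed using 1
  ext t
  constructor
  · rintro ⟨f, hf⟩
    refine ⟨(t, StrongDual.toWeakDual f), ⟨⟨Set.mem_univ _, ?_⟩, hf⟩, rfl⟩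
    have : ‖f‖ ≤ max R 0 := f.opNorm_le_bound (le_max_right _ _) fun z =>
      (hf.2.1 z).trans (mul_le_mul_of_nonneg_right (hNR t) (norm_nonneg z))
    simpa using this
  · rintro ⟨⟨s, f⟩, ⟨-, hf⟩, rfl⟩
    exact ⟨WeakDual.toStrongDual f, hf⟩

/-- Let `E` be a real normed space, `Y ⊆ E` a subspace, `X` a compact
Hausdorff space and `φ : Y → C(X, ℝ)` a bounded linear map whose pointwise norm
function `N t = sup {|φ(y)(t)| : y ∈ Y, ‖y‖ ≤ 1}` is continuous on `X`.  For `x ∈ E`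
let `Φ̄ x t` (resp. `Φ̲ x t`) be the supremum (resp. infimum) of `f x` over all linear
`f : E → ℝ` extending `y ↦ φ(y)(t)` with `‖f‖ = N t`.  Then for every `x` the
function `t ↦ Φ̄ x t` is upper semicontinuous and `t ↦ Φ̲ x t` is lower
semicontinuous. -/
theorem stmt11
    {E : Type*} [NormedAddCommGroup E] [NormedSpace ℝ E]
    {X : Type*} [TopologicalSpace X] [CompactSpace X] [T2Space X]
    (Y : Submodule ℝ E)
    (φ : Y →L[ℝ] C(X, ℝ))
    (N : X → ℝ)
    (hN : ∀ t : X, N t = sSup {r : ℝ | ∃ y : Y, ‖y‖ ≤ 1 ∧ r = |φ y t|})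
    (hNcont : Continuous N)
    (Φsup Φinf : E → X → ℝ)
    (hΦsup : ∀ (x : E) (t : X), Φsup x t =
      sSup {r : ℝ | ∃ f : E →L[ℝ] ℝ,
        (∀ y : Y, f (y : E) = φ y t) ∧ ‖f‖ = N t ∧ r = f x})
    (hΦinf : ∀ (x : E) (t : X), Φinf x t =
      sInf {r : ℝ | ∃ f : E →L[ℝ] ℝ,
        (∀ y : Y, f (y : E) = φ y t) ∧ ‖f‖ = N t ∧ r = f x}) :
    ∀ x : E, UpperSemicontinuous (fun t : X => Φsup x t) ∧
      LowerSemicontinuous (fun t : X => Φinf x t) := by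
  let ψ (t : X) : Y →L[ℝ] ℝ := (ContinuousMap.evalCLM ℝ t).comp φ
  have hψ (t : X) : N t = ‖ψ t‖ := by
    rw [hN t, ← (ψ t).sSup_unitClosedBall_eq_norm]
    congr 1
    ext r
    simp [ψ, eq_comm]
  have hnorm (t : X) (f : E →L[ℝ] ℝ) (hf : ∀ y : Y, f (y : E) = φ y t)
      (hle : ∀ z, |f z| ≤ N t * ‖z‖) : ‖f‖ = N t := by
    refine le_antisymm (f.opNorm_le_bound ((norm_nonneg (ψ t)).trans_eq (hψ t).symm) hle) ?_
    rw [hψ t]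
    refine (ψ t).opNorm_le_bound (norm_nonneg f) fun y => ?_
    have := f.le_opNorm (y : E)
    rwa [hf y] at this
  have hsup (x : E) : UpperSemicontinuous (fun t : X => Φsup x t) := by
    intro t₀ c hc
    obtain ⟨d, hd, hdc⟩ := exists_between hc
    have hmem : t₀ ∉ {t : X | ∃ f : E →L[ℝ] ℝ, (∀ y : Y, f (y : E) = φ y t) ∧
        (∀ z, |f z| ≤ N t * ‖z‖) ∧ d ≤ f x} := by
      rintro ⟨f, hf, hle, hdf⟩
      refine (hd.trans_le hdf).not_ge ?_
      beta_reduce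
      rw [hΦsup]
      refine le_csSup ⟨N t₀ * ‖x‖, ?_⟩ ⟨f, hf, hnorm t₀ f hf hle, rfl⟩
      rintro _ ⟨g, -, hg, rfl⟩
      exact hg ▸ (le_abs_self _).trans (g.le_opNorm x)
    filter_upwards [(isClosed_setOf_exists_extension_le Y φ N hNcont x d).isOpen_compl.mem_nhds
      hmem] with t ht
    refine lt_of_le_of_lt ?_ hdc
    rw [hΦsup]
    refine csSup_le ?_ ?_
    · obtain ⟨g, hg, hgn⟩ := exists_extension_norm_eq Y (ψ t)
      exact ⟨g x, g, hg, hgn.trans (hψ t).symm, rfl⟩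
    · rintro _ ⟨f, hf, hfn, rfl⟩
      by_contra! hlt
      exact ht ⟨f, hf, fun z => hfn ▸ f.le_opNorm z, hlt.le⟩
  intro x
  refine ⟨hsup x, ?_⟩
  have hneg (t : X) : Φinf x t = -Φsup (-x) t := by
    rw [hΦinf, hΦsup, Real.sInf_def]
    congr 2
    ext r
    simp [neg_eq_iff_eq_neg]
  intro t₀ c hc
  have hc' : Φsup (-x) t₀ < -c := by
    have := hneg t₀
    simp only at hc
    linarith
  filter_upwards [hsup (-x) t₀ (-c) hc'] with t ht
  rw [hneg t]
  linarith
end
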